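/- arXiv:1203.6795 — 2 statements merged into one kernel-verified Lean document; each statement's English description precedes it below -/
import Mathlib

section
/- Let L_1, …, L_n be finite lattices, let M be a finite directly indecomposable lattice with at least two elements, and let g : L_1 × ⋯ × L_n → M be a surjective lattice homomorphism (the product carries componentwise operations). Then there exist an index j ∈ {1, …, n} and a surjective lattice homomorphism h : L_j → M such that g = h ∘ π_j, where π_j is the projection onto the j-th factor. -/
/-- `M` decomposes as a product of the lattices `A` and `B`, both with at least two
elements: there is an equivalence `M ≃ A × B` preserving meet and join (the product
carries componentwise operations). -/
def IsLatticeDecomposition (M : Type*) [Lattice M] (A B : Type) [Lattice A]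
    [Lattice B] : Prop :=
  ∃ e : M ≃ A × B,
    (∃ a a' : A, a ≠ a') ∧ (∃ b b' : B, b ≠ b') ∧
    (∀ x y : M, e (x ⊓ y) = e x ⊓ e y) ∧ (∀ x y : M, e (x ⊔ y) = e x ⊔ e y)

/-- A lattice `M` is directly indecomposable if it is not isomorphic to a product of
two lattices each having at least two elements. -/
def DirectlyIndecomposable (M : Type*) [Lattice M] : Prop :=
  ¬ ∃ (A B : Type) (iA : Lattice A) (iB : Lattice B),
      @IsLatticeDecomposition M _ A B iA iB

/-- In a directly indecomposable lattice, one of two complementary elements that distribute over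
joins and decompose every element is the least element. -/
theorem DirectlyIndecomposable.eq_bot_or_eq_bot {M : Type} [Lattice M] [OrderBot M]
    (hind : DirectlyIndecomposable M) {p q : M} (hpq : p ⊓ q = ⊥)
    (hp : ∀ x y : M, (x ⊔ y) ⊓ p = x ⊓ p ⊔ y ⊓ p)
    (hq : ∀ x y : M, (x ⊔ y) ⊓ q = x ⊓ q ⊔ y ⊓ q)
    (hdec : ∀ x : M, x ⊓ p ⊔ x ⊓ q = x) : p = ⊥ ∨ q = ⊥ := by
  by_contra! hne
  have hright (x : Set.Iic p) (y : Set.Iic q) : (x.1 ⊔ y.1) ⊓ p = x.1 := by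
    have hy : y.1 ⊓ p = ⊥ := le_bot_iff.1 <| hpq ▸ le_inf inf_le_right (inf_le_left.trans y.2)
    rw [hp, inf_eq_left.2 x.2, hy, sup_bot_eq]
  have hleft (x : Set.Iic p) (y : Set.Iic q) : (x.1 ⊔ y.1) ⊓ q = y.1 := by
    have hx : x.1 ⊓ q = ⊥ := le_bot_iff.1 <| hpq ▸ le_inf (inf_le_left.trans x.2) inf_le_right
    rw [hq, inf_eq_left.2 y.2, hx, bot_sup_eq]
  let e : M ≃ Set.Iic p × Set.Iic q :=
    { toFun := fun x => (⟨x ⊓ p, inf_le_right⟩, ⟨x ⊓ q, inf_le_right⟩)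
      invFun := fun z => z.1.1 ⊔ z.2.1
      left_inv := hdec
      right_inv := fun z => Prod.ext (Subtype.ext (hright z.1 z.2)) (Subtype.ext (hleft z.1 z.2)) }
  refine hind ⟨Set.Iic p, Set.Iic q, inferInstance, inferInstance, e,
    ⟨⟨p, le_rfl⟩, ⟨⊥, bot_le⟩, fun h => hne.1 (congrArg Subtype.val h)⟩,
    ⟨⟨q, le_rfl⟩, ⟨⊥, bot_le⟩, fun h => hne.2 (congrArg Subtype.val h)⟩, fun x y => ?_,
    fun x y => ?_⟩
  · exact Prod.ext (Subtype.ext (inf_inf_distrib_right x y p))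
      (Subtype.ext (inf_inf_distrib_right x y q))
  · exact Prod.ext (Subtype.ext (hp x y)) (Subtype.ext (hq x y))

/-- For a lattice homomorphism from a product onto a directly indecomposable lattice, each factor
or its complementary factor collapses. -/
theorem DirectlyIndecomposable.map_update_eq_bot_or {ι : Type*} [DecidableEq ι] {L : ι → Type*}
    [∀ i, Lattice (L i)] [∀ i, BoundedOrder (L i)] {M : Type} [Lattice M] [OrderBot M]
    (hind : DirectlyIndecomposable M) (g : LatticeHom (∀ i, L i) M)
    (hg : Function.Surjective g) (hbot : g ⊥ = ⊥) (i : ι) :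
    g (Function.update ⊥ i ⊤) = ⊥ ∨ g (Function.update ⊤ i ⊥) = ⊥ := by
  refine hind.eq_bot_or_eq_bot ?_ (hg.forall₂.2 fun u v => ?_) (hg.forall₂.2 fun u v => ?_)
    (hg.forall.2 fun u => ?_)
  · rw [← map_inf, ← hbot]
    congr 1
    ext j
    obtain rfl | hj := eq_or_ne j i <;> simp [*]
  all_goals
    simp only [← map_inf, ← map_sup]
    congr 1
    ext j
    obtain rfl | hj := eq_or_ne j i <;> simp [*]

/-- A surjective lattice homomorphism from a finite product of finite lattices onto a
finite directly indecomposable lattice with at least two elements factors through one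
of the projections. -/
theorem stmt17 {n : ℕ} (L : Fin n → Type) [∀ i, Fintype (L i)] [∀ i, Lattice (L i)]
    (M : Type) [Fintype M] [Lattice M]
    (hM2 : ∃ a b : M, a ≠ b) (hind : DirectlyIndecomposable M)
    (g : (∀ i, L i) → M) (hsurj : Function.Surjective g)
    (hgm : ∀ u v : ∀ i, L i, g (u ⊓ v) = g u ⊓ g v)
    (hgj : ∀ u v : ∀ i, L i, g (u ⊔ v) = g u ⊔ g v) :
    ∃ (k : Fin n) (h : L k → M), Function.Surjective h ∧
      (∀ a b : L k, h (a ⊓ b) = h a ⊓ h b) ∧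
      (∀ a b : L k, h (a ⊔ b) = h a ⊔ h b) ∧
      g = fun u => h (u k) := by
  have hne (i : Fin n) : Nonempty (L i) := by
    obtain ⟨m, -⟩ := hM2
    obtain ⟨u, -⟩ := hsurj m
    exact ⟨u i⟩
  have : Nonempty M := let ⟨m, _⟩ := hM2; ⟨m⟩
  let _ (i : Fin n) : BoundedOrder (L i) := Fintype.toBoundedOrder (L i)
  let _ : OrderBot M := Fintype.toOrderBot M
  let G : LatticeHom (∀ i, L i) M := ⟨⟨g, hgj⟩, hgm⟩
  have hmono : Monotone g := OrderHomClass.mono G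
  have hbot : g ⊥ = ⊥ := by
    obtain ⟨u, hu⟩ := hsurj ⊥
    exact le_bot_iff.1 (hu ▸ hmono bot_le)
  obtain ⟨k, hk⟩ : ∃ k, g (Function.update ⊥ k ⊤) ≠ ⊥ := by
    by_contra! hall
    have hsup (s : Finset (Fin n)) : g (s.sup fun i => Function.update ⊥ i ⊤) = ⊥ := by
      induction s using Finset.induction_on with
      | empty => simpa using hbot
      | insert i s _ ih => rw [Finset.sup_insert, hgj, hall, ih, sup_bot_eq]
    have htop (u : ∀ i, L i) : g u = ⊥ := by
      refine le_bot_iff.1 ((hmono fun i => ?_).trans (hsup Finset.univ).le)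
      have h := Finset.le_sup (f := fun i => (Function.update ⊥ i ⊤ : ∀ i, L i))
        (Finset.mem_univ i) i
      exact le_top.trans (by simpa using h)
    obtain ⟨a, b, hab⟩ := hM2
    obtain ⟨u, rfl⟩ := hsurj a
    obtain ⟨v, rfl⟩ := hsurj b
    exact hab ((htop u).trans (htop v).symm)
  have hk' : g (Function.update ⊤ k ⊥) = ⊥ :=
    (hind.map_update_eq_bot_or G hsurj hbot k).resolve_left hk
  have hfac (u : ∀ i, L i) : g u = g (Function.update ⊥ k (u k)) := by
    have hu : u ≤ Function.update ⊥ k (u k) ⊔ Function.update ⊤ k ⊥ := by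
      intro j
      obtain rfl | hj := eq_or_ne j k <;> simp [*]
    refine le_antisymm ((hmono hu).trans ?_) (hmono ?_)
    · rw [hgj, hk', sup_bot_eq]
    · exact update_le_iff.2 ⟨le_rfl, fun _ _ => bot_le⟩
  refine ⟨k, fun x => g (Function.update ⊥ k x), fun m => ?_, fun a b => ?_, fun a b => ?_,
    funext hfac⟩
  · obtain ⟨u, rfl⟩ := hsurj m
    exact ⟨u k, (hfac u).symm⟩
  · rw [← hgm, hfac (_ ⊓ _)]
    simp
  · rw [← hgj, hfac (_ ⊔ _)]
    simp
end

section
/- Let T be a finite type, S = 2^T the Boolean algebra of subsets of T, and let G : S^ℤ → S^ℤ be a Boolean-linear cellular automaton, i.e., a block map that is a homomorphism of Boolean algebras for the cellwise Boolean operations on S^ℤ. Then for every t ∈ T, either π_t(G(S^ℤ)) consists of a single configuration, or there exist i ∈ ℤ and t' ∈ T such that π_t ∘ G = π_{t'} ∘ σ^i as functions S^ℤ → 𝟚^ℤ. -/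
/-- The shift map on the full shift `ℤ → α`. -/
def shiftMap {α : Type*} (x : ℤ → α) : ℤ → α := fun i => x (i + 1)

/-- The shift by an arbitrary integer `k` (`shiftZ k = σ^k`). -/
def shiftZ {α : Type*} (k : ℤ) (x : ℤ → α) : ℤ → α := fun i => x (i + k)

/-- A map `F` out of a set `X` of configurations has radius at most `r`. -/
def HasRadius1 {α β : Type*} (X : Set (ℤ → α)) (F : (ℤ → α) → ℤ → β) (r : ℕ) : Prop :=
  ∀ x ∈ X, ∀ y ∈ X, ∀ i : ℤ, (∀ j : ℤ, |j - i| ≤ (r : ℤ) → x j = y j) → F x i = F y i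

/-- The projection `π_t : (2^T)^ℤ → 𝟚^ℤ`, `π_t(x)_i = 1` iff `t ∈ x_i`. -/
noncomputable def piT {T : Type*} (t : T) (x : ℤ → Set T) : ℤ → Bool :=
  fun i => @decide (t ∈ x i) (Classical.propDecidable _)

/-- Shifting by `k` and then by one is shifting by `k + 1`. -/
theorem shiftMap_shiftZ {α : Type*} (k : ℤ) (x : ℤ → α) :
    shiftMap (shiftZ k x) = shiftZ (k + 1) x := by
  funext i
  simp only [shiftMap, shiftZ]
  congr 1
  ring

/-- A map that commutes with the shift commutes with all its integer powers. -/
theorem map_shiftZ_of_map_shiftMap {α β : Type*} (G : (ℤ → α) → (ℤ → β))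
    (hshift : ∀ x, G (shiftMap x) = shiftMap (G x)) (k : ℤ) (x : ℤ → α) :
    G (shiftZ k x) = shiftZ k (G x) := by
  have hinj : Function.Injective (shiftMap : (ℤ → β) → ℤ → β) := by
    intro y z h
    funext i
    simpa [shiftMap] using congrFun h (i - 1)
  induction k using Int.induction_on with
  | zero =>
    have h0 : shiftZ 0 x = x := by
      funext i
      simp [shiftZ]
    have h0' : shiftZ 0 (G x) = G x := by
      funext i
      simp [shiftZ]
    rw [h0, h0']
  | succ n ih => rw [← shiftMap_shiftZ, hshift, ih, shiftMap_shiftZ]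
  | pred n ih =>
    apply hinj
    rw [← hshift, shiftMap_shiftZ, shiftMap_shiftZ, sub_add_cancel, ih]

/-- A Boolean homomorphism from a power set to `Prop` that is true on some finite set is
evaluation at a point. -/
theorem exists_forall_iff_mem_of_finite {ι : Type*} (φ : Set ι → Prop)
    (hinter : ∀ X Y, φ (X ∩ Y) ↔ φ X ∧ φ Y) (hunion : ∀ X Y, φ (X ∪ Y) ↔ φ X ∨ φ Y)
    (hcompl : ∀ X, φ Xᶜ ↔ ¬ φ X) {F : Set ι} (hF : F.Finite) (hφF : φ F) :
    ∃ p, ∀ X, φ X ↔ p ∈ X := by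
  have hempty : ¬ φ ∅ := fun h => by
    have h' := (hinter ∅ ∅ᶜ).1 (by simpa using h)
    exact (hcompl ∅).1 h'.2 h'.1
  obtain ⟨p, hp⟩ : ∃ p, φ {p} := by
    by_contra! hne
    induction F, hF using Set.Finite.induction_on with
    | empty => exact hempty hφF
    | insert _ _ ih =>
      rw [Set.insert_eq, hunion] at hφF
      exact hφF.elim (hne _) ih
  have hmem : ∀ X, p ∈ X → φ X := fun X hX => by
    refine ((hinter {p} X).1 ?_).2
    rwa [Set.inter_eq_left.2 (Set.singleton_subset_iff.2 hX)]
  refine ⟨p, fun X => ⟨fun hX => ?_, hmem X⟩⟩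
  by_contra hpX
  exact (hcompl X).1 (hmem Xᶜ hpX) hX

/-- For a Boolean-linear cellular automaton `G` on `(2^T)^ℤ` (a block map preserving
the cellwise meet, join and complement), every component `t` is either trivial
(`π_t(G(S^ℤ))` is a single configuration) or a shifted copy of a component of the
identity: `π_t ∘ G = π_{t'} ∘ σ^i` for some `i ∈ ℤ` and `t' ∈ T`. -/
theorem stmt19 {T : Type*} [Fintype T]
    (G : (ℤ → Set T) → (ℤ → Set T))
    (hrad : ∃ r : ℕ, HasRadius1 Set.univ G r)
    (hshift : ∀ x : ℤ → Set T, G (shiftMap x) = shiftMap (G x))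
    (hmeet : ∀ x y : ℤ → Set T, G (fun i => x i ∩ y i) = fun i => G x i ∩ G y i)
    (hjoin : ∀ x y : ℤ → Set T, G (fun i => x i ∪ y i) = fun i => G x i ∪ G y i)
    (hcompl : ∀ x : ℤ → Set T, G (fun i => (x i)ᶜ) = fun i => (G x i)ᶜ) :
    ∀ t : T,
      (∃ z : ℤ → Bool, ∀ x : ℤ → Set T, piT t (G x) = z) ∨
      (∃ (i : ℤ) (t' : T), ∀ x : ℤ → Set T, piT t (G x) = shiftZ i (piT t' x)) := by
  intro t
  right
  obtain ⟨r, hr⟩ := hrad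
  let c : Set (ℤ × T) → ℤ → Set T := fun X i => {s | (i, s) ∈ X}
  have huniv : t ∈ G (c Set.univ) 0 := by
    by_contra h
    have h₁ : t ∈ G (c Set.univᶜ) 0 := by
      change t ∈ G (fun i => (c Set.univ i)ᶜ) 0
      rw [hcompl]
      exact h
    have h₂ : t ∈ G (c (Set.univᶜ ∪ Set.univ)) 0 := by
      change t ∈ G (fun i => c Set.univᶜ i ∪ c Set.univ i) 0
      rw [hjoin]
      exact Or.inl h₁
    rw [Set.union_univ] at h₂
    exact h h₂
  let F : Set (ℤ × T) := Set.Icc (-(r : ℤ)) r ×ˢ Set.univ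
  have hF : t ∈ G (c F) 0 := by
    rw [hr (c F) trivial (c Set.univ) trivial 0]
    · exact huniv
    · intro j hj
      ext s
      simpa [c, F, abs_le] using hj
  obtain ⟨⟨j, s⟩, hjs⟩ := exists_forall_iff_mem_of_finite (fun X => t ∈ G (c X) 0)
    (fun X Y => by
      change t ∈ G (fun i => c X i ∩ c Y i) 0 ↔ _
      rw [hmeet]
      rfl)
    (fun X Y => by
      change t ∈ G (fun i => c X i ∪ c Y i) 0 ↔ _
      rw [hjoin]
      rfl)
    (fun X => by
      change t ∈ G (fun i => (c X i)ᶜ) 0 ↔ _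
      rw [hcompl]
      rfl)
    ((Set.finite_Icc _ _).prod Set.finite_univ) hF
  refine ⟨j, s, fun x => funext fun i => ?_⟩
  have h : t ∈ G x i ↔ s ∈ x (i + j) := by
    have h' : t ∈ G (shiftZ i x) 0 ↔ s ∈ x (j + i) := hjs {q | q.2 ∈ shiftZ i x q.1}
    rw [map_shiftZ_of_map_shiftMap G hshift, add_comm j i] at h'
    simpa [shiftZ] using h'
  exact decide_eq_decide.2 h
end
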